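/- Theorem. Assume a_j = K j^{r−1} y^j + O(y^{νj}) (i.e. there is C > 0 with |a_j − K j^{r−1} y^j| ≤ C y^{νj} for all j ≥ 1), where K > 0, r > 0, y > 1 and ν ∈ (0,1). Then there exists a constant κ_1 > 0 such that c_n ∼ κ_1 · y^n · n^{−(r+2)/(2(r+1))} · exp(κ_2 n^{r/(r+1)}) as n → ∞, where κ_2 = ((r+1)/r) · (K Γ(r+1))^{1/(r+1)}. -/

import Mathlib

open Finset Filter

/-- The number of multisets of total size `n` determined by the parameters `a j`
(the number of one-component multisets of size `j`), i.e.
`c_n = Σ_{η ∈ Ω_n} Π_{j=1}^n C(a_j + η_j - 1, η_j)` where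
`Ω_n = {η : Σ_{j=1}^n j·η_j = n}` (indices shifted: `j ∈ Fin n` stands for `j+1`). -/
def multisetCount (a : ℕ → ℕ) (n : ℕ) : ℕ :=
  ∑ η : Fin n → Fin (n + 1),
    if ∑ j : Fin n, (j.1 + 1) * (η j).1 = n then
      ∏ j : Fin n, Nat.choose (a (j.1 + 1) + (η j).1 - 1) (η j).1
    else 0

/-- complex scaling of the Gamma integral -/
lemma gamma_integrable {a : ℝ} (ha : 0 < a) {s : ℂ} (hs : 0 < s.re) :
    MeasureTheory.IntegrableOn (fun t : ℝ => ((t ^ (a - 1) : ℝ) : ℂ) * Complex.exp (-(s * t)))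
      (Set.Ioi 0) := by
  have h1 : MeasureTheory.IntegrableOn (fun t : ℝ => t ^ (a - 1) * Real.exp (-s.re * t))
      (Set.Ioi 0) := by
    have := integrableOn_rpow_mul_exp_neg_mul_rpow (p := 1) (s := a - 1) (b := s.re)
      (by linarith) one_pos hs
    simpa using this
  refine MeasureTheory.Integrable.mono' h1 ?_ ?_
  · refine (Measurable.mul ?_ ?_).aestronglyMeasurable
    · exact Complex.measurable_ofReal.comp (measurable_id.pow_const _)
    · fun_prop
  · filter_upwards [MeasureTheory.ae_restrict_mem measurableSet_Ioi] with t ht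
    have ht' : (0:ℝ) < t := ht
    rw [norm_mul, Complex.norm_exp, Complex.norm_real, Real.norm_of_nonneg (by positivity)]
    simp

lemma gamma_deriv {a : ℝ} (ha : 0 < a) {s : ℂ} (hs : 0 < s.re) :
    DifferentiableAt ℂ (fun s : ℂ => ∫ t : ℝ in Set.Ioi 0,
      ((t ^ (a - 1) : ℝ) : ℂ) * Complex.exp (-(s * t))) s := by
  have h1 : MeasureTheory.IntegrableOn (fun t : ℝ => t ^ a * Real.exp (-(s.re / 2) * t))
      (Set.Ioi 0) := by
    have := integrableOn_rpow_mul_exp_neg_mul_rpow (p := 1) (s := a) (b := s.re / 2)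
      (by linarith) one_pos (by linarith)
    simpa using this
  have := hasDerivAt_integral_of_dominated_loc_of_deriv_le
    (μ := MeasureTheory.volume.restrict (Set.Ioi (0:ℝ)))
    (F := fun (s : ℂ) (t : ℝ) => ((t ^ (a - 1) : ℝ) : ℂ) * Complex.exp (-(s * t)))
    (F' := fun (s : ℂ) (t : ℝ) => ((t ^ (a - 1) : ℝ) : ℂ) * (Complex.exp (-(s * t)) * (-t)))
    (x₀ := s) (s := Metric.ball s (s.re / 2))
    (bound := fun t : ℝ => t ^ a * Real.exp (-(s.re / 2) * t))
    (Metric.ball_mem_nhds _ (by linarith)) ?_ (gamma_integrable ha hs) ?_ ?_ h1 ?_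
  · exact this.2.differentiableAt
  · refine Eventually.of_forall fun x => ?_
    refine (Measurable.mul ?_ ?_).aestronglyMeasurable
    · exact Complex.measurable_ofReal.comp (measurable_id.pow_const _)
    · fun_prop
  · refine (Measurable.mul ?_ ?_).aestronglyMeasurable
    · exact Complex.measurable_ofReal.comp (measurable_id.pow_const _)
    · fun_prop
  · filter_upwards [MeasureTheory.ae_restrict_mem measurableSet_Ioi] with t ht x hx
    have ht' : (0:ℝ) < t := ht
    rw [norm_mul, norm_mul, Complex.norm_exp, Complex.norm_real, norm_neg, Complex.norm_real,
      Real.norm_of_nonneg (by positivity), Real.norm_of_nonneg ht'.le]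
    have e : t ^ a = t ^ (a - 1) * t := by
      rw [← Real.rpow_add_one ht'.ne']; ring_nf
    rw [e]
    have h2 : s.re / 2 ≤ x.re := by
      have := (Complex.abs_re_le_norm (x - s)).trans (by simpa [dist_eq_norm] using (Metric.mem_ball.1 hx).le)
      rw [Complex.sub_re, abs_le] at this
      linarith
    have h3 : Real.exp ((-(x * t)).re) ≤ Real.exp (-(s.re / 2) * t) := by
      apply Real.exp_le_exp.2
      simp
      nlinarith
    calc _ = (t ^ (a - 1) * t) * Real.exp ((-(x * t)).re) := by ring
      _ ≤ _ := by gcongr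
  · refine Eventually.of_forall fun t x _ => ?_
    refine HasDerivAt.const_mul _ ?_
    have : HasDerivAt (fun x : ℂ => -(x * t)) (-(1 * t) : ℂ) x :=
      ((hasDerivAt_id x).mul_const _).neg
    simpa using this.cexp

lemma gamma_complex {a : ℝ} (ha : 0 < a) {s : ℂ} (hs : 0 < s.re) :
    ∫ t : ℝ in Set.Ioi 0, ((t ^ (a - 1) : ℝ) : ℂ) * Complex.exp (-(s * t))
      = (Real.Gamma a : ℂ) * s ^ (-(a:ℂ)) := by
  have hopen : IsOpen {s : ℂ | 0 < s.re} := isOpen_lt continuous_const Complex.continuous_re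
  have hconv : Convex ℝ {s : ℂ | 0 < s.re} := convex_halfSpace_re_gt 0
  have hf : AnalyticOnNhd ℂ (fun s : ℂ => ∫ t : ℝ in Set.Ioi 0,
      ((t ^ (a - 1) : ℝ) : ℂ) * Complex.exp (-(s * t))) {s : ℂ | 0 < s.re} :=
    DifferentiableOn.analyticOnNhd (fun s hs => (gamma_deriv ha hs).differentiableWithinAt) hopen
  have hg : AnalyticOnNhd ℂ (fun s : ℂ => (Real.Gamma a : ℂ) * s ^ (-(a:ℂ))) {s : ℂ | 0 < s.re} := by
    refine DifferentiableOn.analyticOnNhd (fun s hs => ?_) hopen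
    refine DifferentiableAt.differentiableWithinAt ?_
    exact (differentiableAt_id.cpow_const (Or.inl hs)).const_mul _
  refine hf.eqOn_of_preconnected_of_frequently_eq hg hconv.isPreconnected (z₀ := 1) (by simp) ?_ hs
  have key : ∀ x : ℝ, 0 < x → ∫ t : ℝ in Set.Ioi 0, ((t ^ (a - 1) : ℝ) : ℂ) *
      Complex.exp (-((x:ℂ) * t)) = (Real.Gamma a : ℂ) * (x:ℂ) ^ (-(a:ℂ)) := by
    intro x hx
    have := Complex.integral_cpow_mul_exp_neg_mul_Ioi (a := a) (r := x) (by simpa using ha) hx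
    rw [one_div, Complex.inv_cpow _ _ (by rw [Complex.arg_ofReal_of_nonneg hx.le]; exact Real.pi_pos.ne),
      ← Complex.cpow_neg, mul_comm, Complex.Gamma_ofReal] at this
    rw [← this]
    refine MeasureTheory.setIntegral_congr_fun measurableSet_Ioi fun t ht => ?_
    have ht' : (0:ℝ) < t := ht
    rw [Complex.ofReal_cpow ht'.le]; push_cast; rfl
  have hseq : Tendsto (fun k : ℕ => ((1 + 1 / ((k:ℝ) + 1) : ℝ) : ℂ)) atTop (nhdsWithin 1 {1}ᶜ) := by
    refine tendsto_nhdsWithin_iff.2 ⟨?_, Eventually.of_forall fun k => ?_⟩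
    · have := (tendsto_one_div_add_atTop_nhds_zero_nat (𝕜 := ℝ)).const_add 1
      have := (Complex.continuous_ofReal.tendsto _).comp this
      simpa [Function.comp_def] using this
    · have : (0:ℝ) < 1 / ((k:ℝ)+1) := by positivity
      simp only [Set.mem_compl_iff, Set.mem_singleton_iff]
      intro h
      have : (1 + 1 / ((k:ℝ) + 1) : ℝ) = 1 := by exact_mod_cast h
      linarith
  exact hseq.frequently (Eventually.of_forall fun k => key _ (by positivity)).frequently

open scoped FourierTransform

/-- the polylogarithm-type series `∑_{j ≥ 1} j^{r-1} e^{-js}` -/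
noncomputable def Lser (r : ℝ) (s : ℂ) : ℂ :=
  ∑' j : ℕ, ((((j:ℝ) + 1) ^ (r - 1) : ℝ) : ℂ) * Complex.exp (-(s * (((j:ℝ) + 1 : ℝ) : ℂ)))

lemma fourier_gamma {r : ℝ} (hr : 1 < r) {s : ℂ} (hs : 0 < s.re) (m : ℤ) :
    𝓕 (fun t : ℝ => (((max t 0) ^ (r - 1) : ℝ) : ℂ) * Complex.exp (-(s * t))) (m : ℝ)
      = (Real.Gamma r : ℂ) * (s + 2 * Real.pi * m * Complex.I) ^ (-(r:ℂ)) := by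
  rw [Real.fourier_real_eq_integral_exp_smul, ← gamma_complex (by linarith : 0 < r) (by simpa using hs),
    ← MeasureTheory.integral_indicator measurableSet_Ioi]
  congr 1
  ext t
  by_cases ht : 0 < t
  · rw [Set.indicator_of_mem (show t ∈ Set.Ioi 0 from ht), max_eq_left ht.le, smul_eq_mul,
      mul_left_comm, ← Complex.exp_add]
    congr 2
    push_cast
    ring
  · rw [Set.indicator_of_notMem (show t ∉ Set.Ioi 0 from ht), max_eq_right (not_lt.1 ht),
      Real.zero_rpow (by linarith)]
    simp

lemma norm_shift {r : ℝ} (hr : 1 < r) {s : ℂ} (him : |s.im| ≤ Real.pi) (m : ℤ)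
    (hm : m ≠ 0) : ‖(s + 2 * Real.pi * m * Complex.I) ^ (-(r:ℂ))‖ ≤
      Real.pi ^ (-r) * |(m:ℝ)| ^ (-r) := by
  have hpi := Real.pi_pos
  rw [← Complex.ofReal_neg, Complex.norm_cpow_real, ← Real.mul_rpow hpi.le (abs_nonneg _)]
  have h1 : (1:ℝ) ≤ |(m:ℝ)| := by exact_mod_cast Int.one_le_abs hm
  have h2 : Real.pi * |(m:ℝ)| ≤ ‖s + 2 * Real.pi * m * Complex.I‖ := by
    refine le_trans ?_ (Complex.abs_im_le_norm _)
    have : (s + 2 * Real.pi * m * Complex.I).im = s.im + 2 * Real.pi * m := by simp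
    rw [this]
    have h3 : |2 * Real.pi * (m:ℝ)| = 2 * Real.pi * |(m:ℝ)| := by
      rw [abs_mul, abs_of_pos (by positivity)]
    have h4 := abs_sub_abs_le_abs_sub (2 * Real.pi * (m:ℝ)) (-s.im)
    rw [h3, abs_neg, sub_neg_eq_add] at h4
    rw [add_comm s.im]
    nlinarith [h4]
  exact Real.rpow_le_rpow_of_nonpos (by positivity) h2 (by linarith)

lemma poisson_decay {r : ℝ} (hr : 1 < r) {s : ℂ} (hs : 0 < s.re) :
    (fun t : ℝ => (((max t 0) ^ (r - 1) : ℝ) : ℂ) * Complex.exp (-(s * t)))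
      =O[cocompact ℝ] (fun x : ℝ => |x| ^ (-2:ℝ)) := by
  rw [cocompact_eq_atBot_atTop, Asymptotics.isBigO_sup]
  constructor
  · refine Asymptotics.IsBigO.of_bound 1 ?_
    filter_upwards [eventually_le_atBot 0] with t ht
    rw [max_eq_right ht, Real.zero_rpow (by linarith)]
    simp
    positivity
  · have h := (tendsto_rpow_mul_exp_neg_mul_atTop_nhds_zero (r + 1) s.re hs).eventually
      (ge_mem_nhds (show (0:ℝ) < 1 by norm_num))
    refine Asymptotics.IsBigO.of_bound 1 ?_
    filter_upwards [h, eventually_gt_atTop 0] with t h1 ht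
    rw [max_eq_left ht.le, norm_mul, Complex.norm_exp, Complex.norm_real,
      Real.norm_of_nonneg (by positivity), Real.norm_of_nonneg (by positivity), abs_of_pos ht, one_mul]
    have e : t ^ (r - 1) = t ^ (-2:ℝ) * t ^ (r + 1) := by
      rw [← Real.rpow_add ht]; ring_nf
    have e2 : (-(s * t)).re = -s.re * t := by simp
    rw [e, e2, mul_assoc]
    exact mul_le_of_le_one_right (by positivity) h1

lemma summable_shift {r : ℝ} (hr : 1 < r) {s : ℂ} (him : |s.im| ≤ Real.pi) :
    Summable (fun m : ℤ => (s + 2 * Real.pi * m * Complex.I) ^ (-(r:ℂ))) := by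
  refine Summable.of_norm_bounded_eventually
    ((Real.summable_abs_int_rpow hr).mul_left (Real.pi ^ (-r))) ?_
  have : ({0} : Set ℤ).Finite := Set.finite_singleton 0
  filter_upwards [this.compl_mem_cofinite] with m hm
  exact norm_shift hr him m hm

lemma Lser_poisson {r : ℝ} (hr : 1 < r) {s : ℂ} (hs : 0 < s.re) (him : |s.im| ≤ Real.pi) :
    Lser r s = ∑' m : ℤ, (Real.Gamma r : ℂ) * (s + 2 * Real.pi * m * Complex.I) ^ (-(r:ℂ)) := by
  have hc : Continuous (fun t : ℝ => (((max t 0) ^ (r - 1) : ℝ) : ℂ) * Complex.exp (-(s * t))) := by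
    refine Continuous.mul (Complex.continuous_ofReal.comp ?_) (by fun_prop)
    exact (continuous_id.max continuous_const).rpow_const (fun x => Or.inr (by linarith))
  have h := Real.tsum_eq_tsum_fourier_of_rpow_decay_of_summable hc one_lt_two
    (poisson_decay hr hs) (by simp_rw [fourier_gamma hr hs]; exact (summable_shift hr him).mul_left _) 0
  simp_rw [fourier_gamma hr hs] at h
  simp only [zero_add] at h
  have h2 : ∀ n : ℤ, (fourier n) ((0:ℝ) : UnitAddCircle) = 1 := by intro n; simp
  simp_rw [h2, mul_one] at h
  rw [← h]
  have hinj : Function.Injective (fun j : ℕ => (j:ℤ) + 1) := by intro a b; simp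
  rw [Lser, ← hinj.tsum_eq]
  · refine tsum_congr fun j => ?_
    have : ((((j:ℤ) + 1 : ℤ) : ℝ)) = (j:ℝ) + 1 := by push_cast; ring
    simp only [this]
    rw [max_eq_left (by positivity)]
  · intro n hn
    by_contra h
    apply hn
    have hn0 : n ≤ 0 := by
      by_contra h'
      push Not at h'
      exact h ⟨(n - 1).toNat, by simp; omega⟩
    have : (n:ℝ) ≤ 0 := by exact_mod_cast hn0
    simp only
    rw [max_eq_right this, Real.zero_rpow (by linarith)]
    simp

noncomputable def Dser (r : ℝ) (s : ℂ) : ℂ := Lser r s - (Real.Gamma r : ℂ) * s ^ (-(r:ℂ))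

lemma Dser_bound {r : ℝ} (hr : 1 < r) : ∃ M : ℝ, ∀ s : ℂ, 0 < s.re → |s.im| ≤ Real.pi →
    ‖Dser r s‖ ≤ M := by
  refine ⟨∑' m : ℤ, Real.Gamma r * (Real.pi ^ (-r) * |(m:ℝ)| ^ (-r)), fun s hs him => ?_⟩
  have hs1 := ((Real.summable_abs_int_rpow hr).mul_left (Real.pi ^ (-r))).mul_left (Real.Gamma r)
  have hG : 0 < Real.Gamma r := Real.Gamma_pos_of_pos (by linarith)
  have h := ((summable_shift hr him).mul_left (Real.Gamma r : ℂ)).tsum_eq_add_tsum_ite 0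
  rw [Dser, Lser_poisson hr hs him, h]
  simp only [Int.cast_zero, mul_zero, zero_mul, add_zero, add_sub_cancel_left]
  refine tsum_of_norm_bounded hs1.hasSum fun m => ?_
  split_ifs with hm
  · simp; positivity
  · rw [norm_mul, Complex.norm_real, Real.norm_of_nonneg hG.le]
    gcongr
    exact norm_shift hr him m hm

lemma summable_rpow_geom (p : ℝ) {q : ℝ} (hq0 : 0 ≤ q) (hq : q < 1) :
    Summable (fun j : ℕ => ((j:ℝ) + 1) ^ p * q ^ (j + 1)) := by
  have h := summable_pow_mul_geometric_of_norm_lt_one (R := ℝ) ⌈p⌉₊ (r := q)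
    (by rwa [Real.norm_of_nonneg hq0])
  have h' := (summable_nat_add_iff 1).2 h
  refine Summable.of_nonneg_of_le (fun j => by positivity) (fun j => ?_) h'
  push_cast
  gcongr
  rw [← Real.rpow_natCast]
  exact Real.rpow_le_rpow_of_exponent_le (by linarith [(Nat.cast_nonneg j : (0:ℝ) ≤ j)]) (Nat.le_ceil p)

lemma norm_Lterm (p : ℝ) (s : ℂ) (j : ℕ) :
    ‖((((j:ℝ) + 1) ^ p : ℝ) : ℂ) * Complex.exp (-(s * (((j:ℝ) + 1 : ℝ) : ℂ)))‖
      = ((j:ℝ) + 1) ^ p * (Real.exp (-s.re)) ^ (j + 1) := by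
  rw [norm_mul, Complex.norm_exp, Complex.norm_real, Real.norm_of_nonneg (by positivity),
    ← Real.exp_nat_mul]
  congr 2
  rw [Complex.neg_re, Complex.re_mul_ofReal]
  push_cast
  ring

lemma summable_Lterm (p : ℝ) {s : ℂ} (hs : 0 < s.re) :
    Summable (fun j : ℕ => ((((j:ℝ) + 1) ^ p : ℝ) : ℂ) * Complex.exp (-(s * (((j:ℝ) + 1 : ℝ) : ℂ)))) := by
  refine Summable.of_norm ?_
  simp_rw [norm_Lterm]
  exact summable_rpow_geom p (Real.exp_pos _).le (by rw [Real.exp_lt_one_iff]; linarith)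

lemma Lser_deriv (r : ℝ) {s : ℂ} (hs : 0 < s.re) :
    HasDerivAt (Lser r) (-Lser (r + 1) s) s := by
  have hopen : IsOpen {z : ℂ | s.re / 2 < z.re} := isOpen_lt continuous_const Complex.continuous_re
  have hconv : Convex ℝ {z : ℂ | s.re / 2 < z.re} := convex_halfSpace_re_gt _
  have h := hasDerivAt_tsum_of_isPreconnected (𝕜 := ℂ)
    (u := fun j : ℕ => ((j:ℝ) + 1) ^ (r + 1 - 1) * (Real.exp (-(s.re / 2))) ^ (j + 1))
    (g := fun (j : ℕ) (z : ℂ) => ((((j:ℝ) + 1) ^ (r - 1) : ℝ) : ℂ) *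
      Complex.exp (-(z * (((j:ℝ) + 1 : ℝ) : ℂ))))
    (g' := fun (j : ℕ) (z : ℂ) => -(((((j:ℝ) + 1) ^ (r + 1 - 1) : ℝ) : ℂ) *
      Complex.exp (-(z * (((j:ℝ) + 1 : ℝ) : ℂ)))))
    (y₀ := s) (y := s)
    (summable_rpow_geom _ (Real.exp_pos _).le (by rw [Real.exp_lt_one_iff]; linarith))
    hopen hconv.isPreconnected ?_ ?_ (by simp; linarith) (summable_Lterm _ hs) (by simp; linarith)
  · rw [tsum_neg] at h
    exact h
  · intro j z _
    have h1 : HasDerivAt (fun z : ℂ => -(z * (((j:ℝ) + 1 : ℝ) : ℂ))) (-(1 * (((j:ℝ) + 1 : ℝ) : ℂ))) z :=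
      ((hasDerivAt_id z).mul_const _).neg
    have h2 := h1.cexp.const_mul ((((j:ℝ) + 1) ^ (r - 1) : ℝ) : ℂ)
    refine h2.congr_deriv ?_
    have : ((j:ℝ) + 1) ^ (r + 1 - 1) = ((j:ℝ) + 1) ^ (r - 1) * ((j:ℝ) + 1) := by
      rw [← Real.rpow_add_one (by positivity)]; ring_nf
    rw [this, Complex.ofReal_mul]
    ring
  · intro j z hz
    rw [norm_neg, norm_Lterm]
    have : Real.exp (-z.re) ≤ Real.exp (-(s.re / 2)) := Real.exp_le_exp.2 (by simp at hz; linarith)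
    gcongr

lemma Dser_deriv {r : ℝ} (hr : 0 < r) {s : ℂ} (hs : 0 < s.re) :
    HasDerivAt (Dser r) (-Dser (r + 1) s) s := by
  have h1 := Lser_deriv r hs
  have h2 := ((hasDerivAt_id s).cpow_const (c := -(r:ℂ)) (Or.inl hs)).const_mul (Real.Gamma r : ℂ)
  refine (h1.sub h2).congr_deriv ?_
  rw [Dser, Real.Gamma_add_one hr.ne']
  have : -((r + 1 : ℝ) : ℂ) = -(r:ℂ) - 1 := by push_cast; ring
  rw [this]
  push_cast
  simp only [id]
  ring

lemma convex_strip : Convex ℝ {s : ℂ | 0 < s.re ∧ |s.im| ≤ Real.pi} := by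
  have h1 : Convex ℝ {s : ℂ | 0 < s.re} := convex_halfSpace_re_gt 0
  have h2 : Convex ℝ {s : ℂ | s.im ≤ Real.pi} := convex_halfSpace_im_le _
  have h3 : Convex ℝ {s : ℂ | -Real.pi ≤ s.im} := convex_halfSpace_im_ge _
  convert h1.inter (h3.inter h2) using 1
  ext s
  simp [abs_le]

lemma Dser_lim {r : ℝ} (hr : 0 < r) : ∃ (C : ℂ) (M : ℝ), ∀ s : ℂ, 0 < s.re → |s.im| ≤ Real.pi →
    ‖Dser r s - C‖ ≤ M * ‖s‖ := by
  obtain ⟨M, hM⟩ := Dser_bound (r := r + 1) (by linarith)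
  have hlip : ∀ s t : ℂ, (0 < s.re ∧ |s.im| ≤ Real.pi) → (0 < t.re ∧ |t.im| ≤ Real.pi) →
      ‖Dser r t - Dser r s‖ ≤ M * ‖t - s‖ := by
    intro s t hs ht
    exact Convex.norm_image_sub_le_of_norm_hasDerivWithin_le
      (s := {s : ℂ | 0 < s.re ∧ |s.im| ≤ Real.pi})
      (fun x hx => (Dser_deriv hr hx.1).hasDerivWithinAt)
      (fun x hx => by rw [norm_neg]; exact hM x hx.1 hx.2) convex_strip hs ht
  have hM0 : 0 ≤ M := (norm_nonneg _).trans (hM 1 (by simp) (by simp; positivity))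
  let u : ℕ → ℂ := fun k => ((1 / ((k:ℝ) + 1) : ℝ) : ℂ)
  have hu : Tendsto u atTop (nhds 0) := by
    have := (Complex.continuous_ofReal.tendsto _).comp (tendsto_one_div_add_atTop_nhds_zero_nat (𝕜 := ℝ))
    simpa [u, Function.comp_def] using this
  have huS : ∀ k, 0 < (u k).re ∧ |(u k).im| ≤ Real.pi := by
    intro k
    refine ⟨?_, ?_⟩
    · simp only [u, Complex.ofReal_re]; positivity
    · simp only [u, Complex.ofReal_im, abs_zero]; positivity
  have hcau : CauchySeq (fun k => Dser r (u k)) := by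
    have hc := hu.cauchySeq
    rw [Metric.cauchySeq_iff] at hc ⊢
    intro ε hε
    obtain ⟨N, hN⟩ := hc (ε / (M + 1)) (by positivity)
    refine ⟨N, fun m hm n hn => ?_⟩
    have h1 := hN m hm n hn
    rw [dist_eq_norm] at h1 ⊢
    calc _ ≤ M * ‖u m - u n‖ := hlip _ _ (huS n) (huS m)
      _ ≤ (M + 1) * ‖u m - u n‖ := by gcongr; linarith
      _ < (M + 1) * (ε / (M + 1)) := by gcongr
      _ = ε := by field_simp
  obtain ⟨C, hC⟩ := cauchySeq_tendsto_of_complete hcau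
  refine ⟨C, M, fun s hs him => ?_⟩
  have h1 : Tendsto (fun k => ‖Dser r s - Dser r (u k)‖) atTop (nhds ‖Dser r s - C‖) :=
    (tendsto_const_nhds.sub hC).norm
  have h2 : Tendsto (fun k => M * ‖s - u k‖) atTop (nhds (M * ‖s - 0‖)) :=
    ((tendsto_const_nhds.sub hu).norm).const_mul M
  rw [sub_zero] at h2
  exact le_of_tendsto_of_tendsto' h1 h2 fun k => hlip _ _ (huS k) ⟨hs, him⟩

lemma cpow_taylor (r : ℝ) :
    (fun z : ℂ => (1 + z) ^ (-(r:ℂ)) - 1 + r * z - r * (r + 1) / 2 * z ^ 2)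
      =o[nhds 0] (fun z : ℂ => z ^ 2) := by
  set f : ℂ → ℂ := fun z => (1 + z) ^ (-(r:ℂ)) - 1 + r * z - r * (r + 1) / 2 * z ^ 2 with hf
  set f' : ℂ → ℂ := fun z => -(r:ℂ) * (1 + z) ^ (-(r:ℂ) - 1) + r - r * (r + 1) * z with hf'
  have hmem : ∀ z : ℂ, ‖z‖ < 1 → 1 + z ∈ Complex.slitPlane := by
    intro z hz
    left
    have := (abs_le.1 (Complex.abs_re_le_norm z)).1
    simp; linarith
  have h1 : ∀ (c z : ℂ), ‖z‖ < 1 → HasDerivAt (fun z : ℂ => (1 + z) ^ c) (c * (1 + z) ^ (c - 1)) z := by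
    intro c z hz
    have := ((hasDerivAt_id z).const_add 1).cpow_const (c := c) (hmem z hz)
    simpa using this
  have hd : ∀ z : ℂ, ‖z‖ < 1 → HasDerivAt f (f' z) z := by
    intro z hz
    have h2 := (((h1 (-(r:ℂ)) z hz).sub_const 1).add ((hasDerivAt_id z).const_mul (r:ℂ))).sub
      ((hasDerivAt_pow 2 z).const_mul ((r:ℂ) * (r + 1) / 2))
    refine h2.congr_deriv ?_
    simp [hf']
    ring
  have hd2 : HasDerivAt f' 0 0 := by
    have h2 := (((h1 (-(r:ℂ) - 1) 0 (by simp)).const_mul (-(r:ℂ))).add_const (r:ℂ)).sub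
      ((hasDerivAt_id (0:ℂ)).const_mul ((r:ℂ) * (r + 1)))
    refine h2.congr_deriv ?_
    simp
    ring
  have hf0 : f 0 = 0 := by simp [hf]
  have hf'0 : f' 0 = 0 := by simp [hf']
  rw [hasDerivAt_iff_isLittleO] at hd2
  simp only [hf'0, sub_zero, smul_zero] at hd2
  rw [Asymptotics.isLittleO_iff] at hd2 ⊢
  intro ε hε
  obtain ⟨ρ, hρ, hb⟩ := Metric.eventually_nhds_iff.1 (hd2 hε)
  refine Metric.eventually_nhds_iff.2 ⟨min ρ 1, by positivity, fun z hz => ?_⟩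
  simp only [dist_zero_right] at hz hb
  have hz1 : ‖z‖ < 1 := hz.trans_le (min_le_right _ _)
  have hz2 : ‖z‖ < ρ := hz.trans_le (min_le_left _ _)
  have := Convex.norm_image_sub_le_of_norm_hasDerivWithin_le (f := f) (f' := f')
    (s := Metric.closedBall 0 ‖z‖) (x := 0) (y := z) (C := ε * ‖z‖)
    (fun w hw => (hd w (by simp at hw; linarith)).hasDerivWithinAt)
    (fun w hw => by
      simp at hw
      exact (hb (by linarith)).trans (by gcongr)) (convex_closedBall _ _) (by simp) (by simp)
  rw [hf0, sub_zero, sub_zero] at this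
  rw [norm_pow, pow_two, ← mul_assoc]
  exact this

lemma cpow_re_le {r : ℝ} (hr : 0 < r) (u : ℝ) :
    ((1 + u * Complex.I : ℂ) ^ (-(r:ℂ))).re ≤ 1 - r / (4 + r) * min (u ^ 2) 1 := by
  refine (Complex.re_le_norm _).trans ?_
  rw [← Complex.ofReal_neg, Complex.norm_cpow_real]
  set m := min (u ^ 2) 1 with hm
  have hm0 : 0 ≤ m := by positivity
  have hm1 : m ≤ 1 := min_le_right _ _
  have hmu : m ≤ u ^ 2 := min_le_left _ _
  have hn : ‖(1 + u * Complex.I : ℂ)‖ ^ 2 = 1 + u ^ 2 := by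
    rw [← Complex.normSq_eq_norm_sq, Complex.normSq_apply]; simp; ring
  have e1 : ‖(1 + u * Complex.I : ℂ)‖ ^ (-r) = (1 + u ^ 2) ^ (-r / 2) := by
    rw [← hn, ← Real.rpow_natCast, ← Real.rpow_mul (norm_nonneg _)]
    congr 1; push_cast; ring
  rw [e1]
  calc (1 + u ^ 2) ^ (-r / 2) ≤ (1 + m) ^ (-r / 2) :=
        Real.rpow_le_rpow_of_nonpos (by positivity) (by linarith) (by linarith)
    _ = Real.exp (Real.log (1 + m) * (-r / 2)) := Real.rpow_def_of_pos (by positivity) _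
    _ ≤ Real.exp (-(r / 4 * m)) := by
        apply Real.exp_le_exp.2
        have h1 := Real.one_sub_inv_le_log_of_pos (show 0 < 1 + m by positivity)
        have h2 : m / 2 ≤ 1 - (1 + m)⁻¹ := by
          have : 1 - (1 + m)⁻¹ = m / (1 + m) := by field_simp; ring
          rw [this]
          gcongr
          linarith
        nlinarith
    _ ≤ (1 + r / 4 * m)⁻¹ := by
        rw [Real.exp_neg]
        gcongr
        linarith [Real.add_one_le_exp (r / 4 * m)]
    _ ≤ 1 - r / (4 + r) * m := by
        rw [inv_le_iff_one_le_mul₀ (by positivity)]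
        have : (1 - r / (4 + r) * m) * (1 + r / 4 * m) = 1 + r ^ 2 / (4 * (4 + r)) * m * (1 - m) := by
          field_simp; ring
        rw [this]
        have : 0 ≤ r ^ 2 / (4 * (4 + r)) * m * (1 - m) := by
          have : 0 ≤ 1 - m := by linarith
          positivity
        linarith

lemma exponent_eq {A r δ u : ℝ} (hr : 0 < r) (hδ : 0 < δ) :
    (A:ℂ) * ((δ:ℂ) + ((δ * u : ℝ):ℂ) * Complex.I) ^ (-(r:ℂ))
      + ((r * A * δ ^ (-r - 1) : ℝ) : ℂ) * ((δ:ℂ) + ((δ * u : ℝ):ℂ) * Complex.I)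
    = ((r * A * δ ^ (-r) * (1 + 1 / r) : ℝ) : ℂ) + ((r * A * δ ^ (-r) : ℝ) : ℂ) *
      (((1 + u * Complex.I : ℂ) ^ (-(r:ℂ)) - 1) / r + u * Complex.I) := by
  have e1 : ((δ:ℂ) + ((δ * u : ℝ):ℂ) * Complex.I) = (δ:ℂ) * (1 + u * Complex.I) := by
    push_cast; ring
  have e2 : ((δ:ℂ) * (1 + u * Complex.I)) ^ (-(r:ℂ)) = ((δ ^ (-r) : ℝ) : ℂ) * (1 + u * Complex.I) ^ (-(r:ℂ)) := by
    have hne : (1 + u * Complex.I : ℂ) ≠ 0 := by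
      intro h
      have := congrArg Complex.re h
      simp at this
    rw [Complex.cpow_def_of_ne_zero (mul_ne_zero (by exact_mod_cast hδ.ne') hne),
      Complex.log_ofReal_mul hδ hne, add_mul, Complex.exp_add, Complex.cpow_def_of_ne_zero hne,
      Real.rpow_def_of_pos hδ]
    push_cast
    rfl
  have e3 : δ ^ (-r) = δ ^ (-r - 1) * δ := by
    rw [← Real.rpow_add_one hδ.ne']; ring_nf
  rw [e1, e2, e3]
  have : (r:ℂ) ≠ 0 := by exact_mod_cast hr.ne'
  push_cast
  field_simp
  ring

lemma saddle {A r : ℝ} (hA : 0 < A) (hr : 0 < r) (H : ℂ → ℂ) (H0 : ℂ) (M : ℝ)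
    (hHc : ContinuousOn H {s | 0 < s.re})
    (hHb : ∀ s : ℂ, 0 < s.re → s.re ≤ 1 → |s.im| ≤ Real.pi → ‖H s‖ ≤ M)
    (hH0 : Tendsto H (nhdsWithin 0 {s : ℂ | 0 < s.re ∧ |s.im| ≤ Real.pi}) (nhds H0)) :
    Tendsto (fun δ : ℝ => ((Real.sqrt (r * A * δ ^ (-r)) / δ *
        Real.exp (-(r * A * δ ^ (-r) * (1 + 1 / r))) : ℝ) : ℂ) *
      ∫ θ in (-Real.pi)..Real.pi, Complex.exp ((A:ℂ) * ((δ:ℂ) + (θ:ℂ) * Complex.I) ^ (-(r:ℂ))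
        + ((r * A * δ ^ (-r - 1) : ℝ) : ℂ) * ((δ:ℂ) + (θ:ℂ) * Complex.I)
        + H ((δ:ℂ) + (θ:ℂ) * Complex.I)))
      (nhdsWithin 0 (Set.Ioi 0))
      (nhds (Complex.exp H0 * (Real.sqrt (Real.pi / ((r + 1) / 2)) : ℂ))) := by
  have hpi := Real.pi_pos
  set N : ℝ → ℝ := fun δ => r * A * δ ^ (-r) with hN
  set φ : ℝ → ℂ := fun u => ((1 + u * Complex.I : ℂ) ^ (-(r:ℂ)) - 1) / r + u * Complex.I with hφ
  set c : ℝ → ℝ := fun δ => δ / Real.sqrt (N δ) with hc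
  set P : ℝ → ℝ → ℂ := fun δ v => Complex.exp ((N δ : ℂ) * φ (v / Real.sqrt (N δ))
    + H ((δ:ℂ) + ((c δ * v : ℝ) : ℂ) * Complex.I)) with hP
  have hNpos : ∀ δ : ℝ, 0 < δ → 0 < N δ := fun δ hδ => by simp only [hN]; positivity
  have hcpos : ∀ δ : ℝ, 0 < δ → 0 < c δ := fun δ hδ => by
    have := hNpos δ hδ; simp only [hc]; positivity
  -- limits
  have hNlim : Tendsto N (nhdsWithin 0 (Set.Ioi 0)) atTop := by
    have := tendsto_rpow_neg_nhdsGT_zero (y := -r) (by linarith)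
    exact this.const_mul_atTop (by positivity)
  have hsqlim : Tendsto (fun δ => Real.sqrt (N δ)) (nhdsWithin 0 (Set.Ioi 0)) atTop :=
    Real.tendsto_sqrt_atTop.comp hNlim
  have hδlim : Tendsto (fun δ : ℝ => δ) (nhdsWithin 0 (Set.Ioi 0)) (nhds 0) :=
    tendsto_id.mono_left nhdsWithin_le_nhds
  have hclim : Tendsto c (nhdsWithin 0 (Set.Ioi 0)) (nhds 0) := hδlim.div_atTop hsqlim
  have hpos : ∀ᶠ δ : ℝ in nhdsWithin 0 (Set.Ioi 0), 0 < δ := self_mem_nhdsWithin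
  -- change of variables
  have hchange : ∀ δ : ℝ, 0 < δ → ((Real.sqrt (r * A * δ ^ (-r)) / δ *
        Real.exp (-(r * A * δ ^ (-r) * (1 + 1 / r))) : ℝ) : ℂ) *
      (∫ θ in (-Real.pi)..Real.pi, Complex.exp ((A:ℂ) * ((δ:ℂ) + (θ:ℂ) * Complex.I) ^ (-(r:ℂ))
        + ((r * A * δ ^ (-r - 1) : ℝ) : ℂ) * ((δ:ℂ) + (θ:ℂ) * Complex.I)
        + H ((δ:ℂ) + (θ:ℂ) * Complex.I)))
      = ∫ v, (Set.Ioc (-(Real.pi / c δ)) (Real.pi / c δ)).indicator (P δ) v := by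
    intro δ hδ
    have hNδ := hNpos δ hδ
    have hcδ := hcpos δ hδ
    have hsq : 0 < Real.sqrt (N δ) := Real.sqrt_pos.2 hNδ
    rw [MeasureTheory.integral_indicator measurableSet_Ioc,
      ← intervalIntegral.integral_of_le (by have : 0 < Real.pi / c δ := by positivity
                                            linarith)]
    have h1 := intervalIntegral.integral_comp_mul_left (a := -(Real.pi / c δ)) (b := Real.pi / c δ)
      (fun θ : ℝ => Complex.exp ((A:ℂ) * ((δ:ℂ) + (θ:ℂ) * Complex.I) ^ (-(r:ℂ))
        + ((r * A * δ ^ (-r - 1) : ℝ) : ℂ) * ((δ:ℂ) + (θ:ℂ) * Complex.I)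
        + H ((δ:ℂ) + (θ:ℂ) * Complex.I))) hcδ.ne'
    have e1 : c δ * (-(Real.pi / c δ)) = -Real.pi := by field_simp
    have e2 : c δ * (Real.pi / c δ) = Real.pi := by field_simp
    rw [e1, e2] at h1
    have e3 : (c δ)⁻¹ = Real.sqrt (r * A * δ ^ (-r)) / δ := by simp only [hc, hN, inv_div]
    rw [mul_comm (Real.sqrt _ / δ), Complex.ofReal_mul, mul_assoc, ← e3, ← Complex.real_smul (x := (c δ)⁻¹),
      ← h1, ← intervalIntegral.integral_const_mul]
    refine intervalIntegral.integral_congr fun v _ => ?_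
    simp only [hP]
    have e4 : c δ * v = δ * (v / Real.sqrt (N δ)) := by simp only [hc]; ring
    rw [e4, exponent_eq hr hδ, Complex.ofReal_exp, ← Complex.exp_add]
    congr 1
    simp only [hN, hφ]
    push_cast
    ring
  have hmain : Tendsto (fun δ : ℝ => ∫ v, (Set.Ioc (-(Real.pi / c δ)) (Real.pi / c δ)).indicator (P δ) v)
      (nhdsWithin 0 (Set.Ioi 0))
      (nhds (∫ v : ℝ, Complex.exp H0 * ((Real.exp (-((r + 1) / 2) * v ^ 2) : ℝ) : ℂ))) := by
    set c' : ℝ := 1 / (4 + r) with hc'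
    have hc'pos : 0 < c' := by positivity
    refine MeasureTheory.tendsto_integral_filter_of_dominated_convergence
      (fun v => Real.exp M * (Real.exp (-c' * v ^ 2) + (1 + v ^ 2)⁻¹)) ?_ ?_ ?_ ?_
    · filter_upwards [hpos] with δ hδ
      refine MeasureTheory.AEStronglyMeasurable.indicator ?_ measurableSet_Ioc
      refine Continuous.aestronglyMeasurable ?_
      refine Complex.continuous_exp.comp (Continuous.add ?_ ?_)
      · refine continuous_const.mul ?_
        simp only [hφ]
        refine Continuous.add (Continuous.div_const (Continuous.sub ?_ continuous_const) _) (by fun_prop)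
        refine Continuous.cpow (by fun_prop) continuous_const ?_
        intro v
        left
        simp
      · refine hHc.comp_continuous (by fun_prop) ?_
        intro v
        simpa using hδ
    · -- domination
      have hdom : ∀ᶠ δ : ℝ in nhdsWithin 0 (Set.Ioi 0),
          (1 + (Real.pi / c δ) ^ 2) * Real.exp (-c' * N δ) ≤ 1 := by
        have h1 : Tendsto (fun x : ℝ => x ^ (0:ℝ) * Real.exp (-c' * x)
            + Real.pi ^ 2 / (r * A) ^ (2 / r) * (x ^ (1 + 2 / r) * Real.exp (-c' * x))) atTop (nhds 0) := by
          have := (tendsto_rpow_mul_exp_neg_mul_atTop_nhds_zero 0 c' hc'pos).add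
            ((tendsto_rpow_mul_exp_neg_mul_atTop_nhds_zero (1 + 2 / r) c' hc'pos).const_mul
              (Real.pi ^ 2 / (r * A) ^ (2 / r)))
          simpa using this
        have h2 := (h1.comp hNlim).eventually (ge_mem_nhds (show (0:ℝ) < 1 by norm_num))
        filter_upwards [h2, hpos] with δ h3 hδ
        refine le_trans (le_of_eq ?_) h3
        have hNδ := hNpos δ hδ
        have e1 : (Real.pi / c δ) ^ 2 = Real.pi ^ 2 * N δ * (δ ^ 2)⁻¹ := by
          simp only [hc]
          rw [div_pow, div_pow, Real.sq_sqrt hNδ.le]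
          field_simp
        have e2 : (δ ^ 2)⁻¹ = (N δ) ^ (2 / r) / (r * A) ^ (2 / r) := by
          rw [← Real.div_rpow hNδ.le (by positivity)]
          have : N δ / (r * A) = δ ^ (-r) := by simp only [hN]; field_simp
          rw [this, ← Real.rpow_mul hδ.le, ← Real.rpow_natCast, ← Real.rpow_neg hδ.le]
          congr 1
          field_simp
          norm_num
        simp only [Function.comp]
        rw [e1, e2, Real.rpow_zero, Real.rpow_add hNδ, Real.rpow_one]
        ring
      filter_upwards [hdom, hpos, hδlim.eventually (ge_mem_nhds (show (0:ℝ) < 1 by norm_num))] with δ hd hδ hδ1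
      refine Eventually.of_forall fun v => ?_
      have hNδ := hNpos δ hδ
      have hcδ := hcpos δ hδ
      by_cases hv : v ∈ Set.Ioc (-(Real.pi / c δ)) (Real.pi / c δ)
      · rw [Set.indicator_of_mem hv]
        have habs : |v| ≤ Real.pi / c δ := abs_le.2 ⟨hv.1.le, hv.2⟩
        have hH1 : ‖H ((δ:ℂ) + ((c δ * v : ℝ) : ℂ) * Complex.I)‖ ≤ M := by
          apply hHb
          · simpa using hδ
          · simpa using hδ1
          · have : ((δ:ℂ) + ((c δ * v : ℝ) : ℂ) * Complex.I).im = c δ * v := by simp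
            rw [this, abs_mul, abs_of_pos hcδ]
            calc c δ * |v| ≤ c δ * (Real.pi / c δ) := by gcongr
              _ = Real.pi := by field_simp
        have hre : ((N δ : ℂ) * φ (v / Real.sqrt (N δ))).re ≤ -c' * min (v ^ 2) (N δ) := by
          rw [Complex.re_ofReal_mul]
          have h1 := cpow_re_le hr (v / Real.sqrt (N δ))
          have h2 : (φ (v / Real.sqrt (N δ))).re =
              (((1 + (v / Real.sqrt (N δ) : ℝ) * Complex.I : ℂ) ^ (-(r:ℂ))).re - 1) / r := by
            simp only [hφ]
            rw [Complex.add_re, Complex.div_ofReal_re]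
            simp
          rw [h2]
          have h3 : N δ * min ((v / Real.sqrt (N δ)) ^ 2) 1 = min (v ^ 2) (N δ) := by
            rw [mul_min_of_nonneg _ _ hNδ.le, div_pow, Real.sq_sqrt hNδ.le, mul_one]
            congr 1
            field_simp
          rw [← h3]
          have h4 : (((1 + (v / Real.sqrt (N δ) : ℝ) * Complex.I : ℂ) ^ (-(r:ℂ))).re - 1) / r ≤
              -c' * min ((v / Real.sqrt (N δ)) ^ 2) 1 := by
            rw [div_le_iff₀ hr]
            have : -c' * min ((v / Real.sqrt (N δ)) ^ 2) 1 * r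
                = - (r / (4 + r) * min ((v / Real.sqrt (N δ)) ^ 2) 1) := by
              simp only [hc']; ring
            rw [this]
            linarith
          calc _ ≤ N δ * (-c' * min ((v / Real.sqrt (N δ)) ^ 2) 1) := by gcongr
            _ = _ := by ring
        simp only [hP]
        rw [Complex.norm_exp, Complex.add_re, Real.exp_add, mul_comm]
        have hb1 : Real.exp (H ((δ:ℂ) + ((c δ * v : ℝ) : ℂ) * Complex.I)).re ≤ Real.exp M :=
          Real.exp_le_exp.2 ((Complex.re_le_norm _).trans hH1)
        have hb2 : Real.exp ((N δ : ℂ) * φ (v / Real.sqrt (N δ))).re ≤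
            Real.exp (-c' * v ^ 2) + (1 + v ^ 2)⁻¹ := by
          refine (Real.exp_le_exp.2 hre).trans ?_
          rcases min_choice (v ^ 2) (N δ) with h | h
          · rw [h]
            have : 0 < (1 + v ^ 2)⁻¹ := by positivity
            linarith
          · rw [h]
            have h5 : Real.exp (-c' * N δ) ≤ (1 + v ^ 2)⁻¹ := by
              rw [le_inv_comm₀ (Real.exp_pos _) (by positivity)]
              have h6 : v ^ 2 ≤ (Real.pi / c δ) ^ 2 := by
                rw [← sq_abs v]; gcongr
              have h7 : 1 + (Real.pi / c δ) ^ 2 ≤ (Real.exp (-c' * N δ))⁻¹ := by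
                rw [le_inv_comm₀ (by positivity) (Real.exp_pos _), ← one_div, le_div_iff₀ (by positivity), mul_comm]
                exact hd
              linarith
            have := Real.exp_pos (-c' * v ^ 2)
            linarith
        gcongr
      · rw [Set.indicator_of_notMem hv, norm_zero]
        positivity
    · exact ((integrable_exp_neg_mul_sq hc'pos).add integrable_inv_one_add_sq).const_mul _
    · refine Eventually.of_forall fun v => ?_
      have hwin : ∀ᶠ δ : ℝ in nhdsWithin 0 (Set.Ioi 0), |c δ * v| < Real.pi := by
        have := (hclim.mul_const v).abs
        simp only [zero_mul, abs_zero] at this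
        exact this.eventually (gt_mem_nhds hpi)
      have hPlim : Tendsto (fun δ => P δ v) (nhdsWithin 0 (Set.Ioi 0))
          (nhds (Complex.exp (((-((r + 1) / 2) * v ^ 2 : ℝ) : ℂ) + H0))) := by
        refine (Complex.continuous_exp.tendsto _).comp (Tendsto.add ?_ ?_)
        · -- Taylor
          set z : ℝ → ℂ := fun δ => ((v / Real.sqrt (N δ) : ℝ) : ℂ) * Complex.I with hz
          have hzlim : Tendsto z (nhdsWithin 0 (Set.Ioi 0)) (nhds 0) := by
            have h1 : Tendsto (fun δ => v / Real.sqrt (N δ)) (nhdsWithin 0 (Set.Ioi 0)) (nhds 0) :=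
              tendsto_const_nhds.div_atTop hsqlim
            have := ((Complex.continuous_ofReal.tendsto _).comp h1).mul_const Complex.I
            simpa [hz, Function.comp_def] using this
          have h1 := (cpow_taylor r).comp_tendsto hzlim
          have h2 := (Asymptotics.isBigO_refl (fun δ => (N δ : ℂ) / r) (nhdsWithin 0 (Set.Ioi 0))).mul_isLittleO h1
          have hr' : (r:ℂ) ≠ 0 := by exact_mod_cast hr.ne'
          have hNz : ∀ δ : ℝ, 0 < δ → (N δ : ℂ) * z δ ^ 2 = -(v:ℂ) ^ 2 := by
            intro δ hδ
            have hNδ := hNpos δ hδ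
            simp only [hz]
            rw [mul_pow, Complex.I_sq, ← Complex.ofReal_pow, div_pow, Real.sq_sqrt hNδ.le]
            have : (N δ : ℂ) ≠ 0 := by exact_mod_cast hNδ.ne'
            push_cast
            field_simp
          have h3 : (fun δ => (N δ : ℂ) / r * ((fun z : ℂ => z ^ 2) ∘ z) δ) =ᶠ[nhdsWithin 0 (Set.Ioi 0)]
              fun _ => -(v:ℂ) ^ 2 / r := by
            filter_upwards [hpos] with δ hδ
            simp only [Function.comp]
            rw [div_mul_eq_mul_div, hNz δ hδ]
          have h4 := h2.trans_eventuallyEq h3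
          have h5 := (h4.trans_isBigO (Asymptotics.isBigO_const_const (-(v:ℂ) ^ 2 / r) (one_ne_zero (α := ℂ)) _))
          rw [Asymptotics.isLittleO_one_iff] at h5
          have h6 := h5.add_const (((-((r + 1) / 2) * v ^ 2 : ℝ) : ℂ))
          rw [zero_add] at h6
          refine h6.congr' ?_
          filter_upwards [hpos] with δ hδ
          simp only [Function.comp, hφ]
          have h7 := hNz δ hδ
          have h8 : ((v / Real.sqrt (N δ) : ℝ) : ℂ) * Complex.I = z δ := rfl
          rw [h8]
          push_cast
          have h9 : ((v:ℂ)) ^ 2 = -((N δ : ℂ) * z δ ^ 2) := by rw [h7]; ring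
          rw [h9]
          field_simp
          ring
        · refine hH0.comp (tendsto_nhdsWithin_iff.2 ⟨?_, ?_⟩)
          · have h1 := ((Complex.continuous_ofReal.tendsto _).comp hδlim).add
              (((Complex.continuous_ofReal.tendsto _).comp (hclim.mul_const v)).mul_const Complex.I)
            simpa [Function.comp_def] using h1
          · filter_upwards [hpos, hwin] with δ hδ hw
            refine ⟨by simpa using hδ, ?_⟩
            have : ((δ:ℂ) + ((c δ * v : ℝ) : ℂ) * Complex.I).im = c δ * v := by simp
            rw [this]
            exact hw.le
      rw [Complex.ofReal_exp, ← Complex.exp_add, add_comm H0]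
      refine hPlim.congr' ?_
      filter_upwards [hpos, hwin] with δ hδ hw
      have hcδ := hcpos δ hδ
      rw [Set.indicator_of_mem]
      rw [abs_mul, abs_of_pos hcδ, mul_comm, ← lt_div_iff₀ hcδ, abs_lt] at hw
      exact ⟨hw.1, hw.2.le⟩
  rw [MeasureTheory.integral_const_mul, integral_complex_ofReal, integral_gaussian] at hmain
  refine hmain.congr' ?_
  filter_upwards [hpos] with δ hδ
  exact (hchange δ hδ).symm

noncomputable def facSer (a : ℕ → ℕ) (j : ℕ) : PowerSeries ℂ :=
  PowerSeries.mk fun m => if (j + 1) ∣ m then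
    (((a (j + 1) + m / (j + 1) - 1).choose (m / (j + 1)) : ℕ) : ℂ) else 0

lemma hasSum_negbinom (a : ℕ) {w : ℂ} (hw : ‖w‖ < 1) :
    HasSum (fun k : ℕ => (((a + k - 1).choose k : ℕ) : ℂ) * w ^ k) (((1 - w) ^ a)⁻¹) := by
  rcases a with _ | b
  · have : (fun k : ℕ => (((0 + k - 1).choose k : ℕ) : ℂ) * w ^ k) = fun k => if k = 0 then 1 else 0 := by
      ext k
      rcases k with _ | k
      · simp
      · simp
    rw [this]
    simpa using hasSum_ite_eq (0:ℕ) (1:ℂ)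
  · have := hasSum_choose_mul_geometric_of_norm_lt_one b hw
    rw [one_div] at this
    have e : (fun k : ℕ => (((b + 1 + k - 1).choose k : ℕ) : ℂ) * w ^ k)
        = fun n : ℕ => (((n + b).choose b : ℕ) : ℂ) * w ^ n := by
      ext k
      have h2 : b + 1 + k - 1 = k + b := by omega
      rw [h2, Nat.choose_symm_add]
    rw [e]
    exact this

lemma facSer_hasSum (a : ℕ → ℕ) (j : ℕ) {z : ℂ} (hz : ‖z‖ < 1) :
    HasSum (fun m => PowerSeries.coeff m (facSer a j) * z ^ m) (((1 - z ^ (j + 1)) ^ a (j + 1))⁻¹) := by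
  have hw : ‖z ^ (j + 1)‖ < 1 := by
    rw [norm_pow]; exact pow_lt_one₀ (norm_nonneg _) hz (by omega)
  have h := hasSum_negbinom (a (j + 1)) hw
  have hinj : Function.Injective (fun k : ℕ => (j + 1) * k) :=
    fun x y h => Nat.eq_of_mul_eq_mul_left (by omega) h
  rw [← hinj.hasSum_iff]
  · convert h using 2 with k
    simp only [Function.comp, facSer, PowerSeries.coeff_mk]
    rw [if_pos (dvd_mul_right _ _), Nat.mul_div_cancel_left _ (by omega), pow_mul]
  · intro m hm
    simp only [facSer, PowerSeries.coeff_mk]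
    rw [if_neg, zero_mul]
    rintro ⟨k, rfl⟩
    exact hm ⟨k, rfl⟩

lemma hasSum_mul_series {p q : PowerSeries ℂ} {z u v : ℂ}
    (hp : HasSum (fun m => PowerSeries.coeff m p * z ^ m) u)
    (hq : HasSum (fun m => PowerSeries.coeff m q * z ^ m) v) :
    HasSum (fun m => PowerSeries.coeff m (p * q) * z ^ m) (u * v) := by
  have h1 := summable_norm_sum_mul_antidiagonal_of_summable_norm hp.summable.norm hq.summable.norm
  have h2 := tsum_mul_tsum_eq_tsum_sum_antidiagonal_of_summable_norm hp.summable.norm hq.summable.norm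
  rw [hp.tsum_eq, hq.tsum_eq] at h2
  have e : (fun m => PowerSeries.coeff m (p * q) * z ^ m) = fun n => ∑ kl ∈ Finset.HasAntidiagonal.antidiagonal n,
      PowerSeries.coeff kl.1 p * z ^ kl.1 * (PowerSeries.coeff kl.2 q * z ^ kl.2) := by
    ext n
    rw [PowerSeries.coeff_mul, Finset.sum_mul]
    refine Finset.sum_congr rfl fun kl hkl => ?_
    rw [← Finset.HasAntidiagonal.mem_antidiagonal.1 hkl, pow_add]
    ring
  rw [e, h2]
  exact h1.of_norm.hasSum

lemma prod_hasSum (a : ℕ → ℕ) (M : ℕ) {z : ℂ} (hz : ‖z‖ < 1) :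
    HasSum (fun m => PowerSeries.coeff m (∏ j ∈ Finset.range M, facSer a j) * z ^ m)
      (∏ j ∈ Finset.range M, ((1 - z ^ (j + 1)) ^ a (j + 1))⁻¹) := by
  induction M with
  | zero =>
    simp only [Finset.range_zero, Finset.prod_empty, PowerSeries.coeff_one]
    have := hasSum_ite_eq (0:ℕ) (1:ℂ)
    convert this using 2 with m
    split_ifs with h <;> simp [h]
  | succ M ih =>
    rw [Finset.prod_range_succ, Finset.prod_range_succ]
    exact hasSum_mul_series ih (facSer_hasSum a M hz)

lemma coeff_prod_congr (n : ℕ) (s : Finset ℕ) (f g : ℕ → PowerSeries ℂ)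
    (h : ∀ j ∈ s, ∀ d ≤ n, PowerSeries.coeff d (f j) = PowerSeries.coeff d (g j)) :
    ∀ d ≤ n, PowerSeries.coeff d (∏ j ∈ s, f j) = PowerSeries.coeff d (∏ j ∈ s, g j) := by
  classical
  induction s using Finset.induction_on with
  | empty => intro d _; simp
  | insert i s hi ih =>
    intro d hd
    rw [Finset.prod_insert hi, Finset.prod_insert hi, PowerSeries.coeff_mul, PowerSeries.coeff_mul]
    refine Finset.sum_congr rfl fun kl hkl => ?_
    have := Finset.HasAntidiagonal.mem_antidiagonal.1 hkl
    rw [h i (Finset.mem_insert_self _ _) kl.1 (by omega),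
      ih (fun j hj => h j (Finset.mem_insert_of_mem hj)) kl.2 (by omega)]

lemma multisetCount_eq_coeff (a : ℕ → ℕ) (n M : ℕ) (hM : n ≤ M) :
    (multisetCount a n : ℂ) = PowerSeries.coeff n (∏ j ∈ Finset.range M, facSer a j) := by
  classical
  set T : ℕ → PowerSeries ℂ := fun j => ∑ k : Fin (n + 1),
    PowerSeries.monomial ((j + 1) * k.1) (((a (j + 1) + k.1 - 1).choose k.1 : ℕ) : ℂ) with hT
  have hstep : PowerSeries.coeff n (∏ j ∈ Finset.range M, facSer a j)
      = PowerSeries.coeff n (∏ j ∈ Finset.range M, if j < n then T j else 1) := by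
    refine coeff_prod_congr n _ _ _ ?_ n le_rfl
    intro j _ d hd
    by_cases hj : j < n
    · rw [if_pos hj]
      simp only [facSer, hT, PowerSeries.coeff_mk, map_sum, PowerSeries.coeff_monomial]
      split_ifs with hdvd
      · obtain ⟨k, rfl⟩ := hdvd
        have hk : k < n + 1 := by nlinarith
        rw [Finset.sum_eq_single (⟨k, hk⟩ : Fin (n + 1))]
        · rw [if_pos rfl, Nat.mul_div_cancel_left _ (by omega)]
        · intro b _ hb
          rw [if_neg]
          intro h
          apply hb
          ext
          exact (Nat.eq_of_mul_eq_mul_left (by omega) h).symm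
        · simp
      · symm
        refine Finset.sum_eq_zero fun k _ => ?_
        rw [if_neg]
        rintro rfl
        exact hdvd (dvd_mul_right _ _)
    · rw [if_neg hj]
      simp only [facSer, PowerSeries.coeff_mk, PowerSeries.coeff_one]
      rcases Nat.eq_zero_or_pos d with rfl | hd0
      · simp
      · have h0 : ¬ (j + 1 ∣ d) := by
          intro h
          have := Nat.le_of_dvd hd0 h
          omega
        rw [if_neg h0, if_neg (by omega)]
  rw [hstep]
  have h2 : (∏ j ∈ Finset.range M, if j < n then T j else 1) = ∏ j : Fin n, T j.1 := by
    rw [Fin.prod_univ_eq_prod_range (fun j => T j) n]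
    rw [← Finset.prod_filter]
    congr 1
    ext j
    simp
    omega
  rw [h2]
  simp only [hT]
  rw [Finset.prod_univ_sum, Fintype.piFinset_univ, map_sum, multisetCount]
  push_cast
  refine Finset.sum_congr rfl fun η _ => ?_
  have h3 : ∏ j : Fin n, PowerSeries.monomial ((j.1 + 1) * (η j).1)
      (((a (j.1 + 1) + (η j).1 - 1).choose (η j).1 : ℕ) : ℂ)
      = PowerSeries.monomial (∑ j : Fin n, (j.1 + 1) * (η j).1)
        (∏ j : Fin n, (((a (j.1 + 1) + (η j).1 - 1).choose (η j).1 : ℕ) : ℂ)) := by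
    rw [PowerSeries.prod_monomial]
  rw [h3, PowerSeries.coeff_monomial]
  by_cases h : ∑ j : Fin n, (j.1 + 1) * (η j).1 = n
  · rw [if_pos h, if_pos h.symm]; 
  · rw [if_neg h, if_neg (Ne.symm h)]

lemma integral_exp_int (k : ℤ) : ∫ θ in (-Real.pi)..Real.pi, Complex.exp ((k:ℂ) * Complex.I * (θ:ℂ))
    = if k = 0 then 2 * (Real.pi : ℂ) else 0 := by
  split_ifs with h
  · subst h
    simp
    ring
  · have hc : (k:ℂ) * Complex.I ≠ 0 := mul_ne_zero (by exact_mod_cast h) Complex.I_ne_zero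
    rw [integral_exp_mul_complex hc]
    have : Complex.exp ((k:ℂ) * Complex.I * ((Real.pi:ℝ):ℂ)) = Complex.exp ((k:ℂ) * Complex.I * ((-Real.pi:ℝ):ℂ)) := by
      rw [Complex.exp_eq_exp_iff_exists_int]
      refine ⟨k, ?_⟩
      push_cast; ring
    rw [this, sub_self, zero_div]

lemma cauchy_coeff (b : ℕ → ℂ) (F : ℂ → ℂ) {ρ : ℝ} (hρ : 0 < ρ)
    (hF : ∀ z : ℂ, ‖z‖ = ρ → HasSum (fun m => b m * z ^ m) (F z)) (n : ℕ) :
    ∫ θ in (-Real.pi)..Real.pi, F ((ρ:ℂ) * Complex.exp (-((θ:ℂ) * Complex.I))) * Complex.exp (n * ((θ:ℂ) * Complex.I))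
     = 2 * Real.pi * (b n * (ρ:ℂ) ^ n) := by
  have hz : ∀ θ : ℝ, ‖(ρ:ℂ) * Complex.exp (-((θ:ℂ) * Complex.I))‖ = ρ := by
    intro θ
    rw [norm_mul, ← neg_mul, ← Complex.ofReal_neg, Complex.norm_exp_ofReal_mul_I]
    simp [abs_of_pos hρ]
  let f : ℕ → C(ℝ, ℂ) := fun m => ⟨fun θ : ℝ => b m * (ρ:ℂ) ^ m * Complex.exp (((((n:ℤ) - (m:ℤ) : ℤ)):ℂ) * Complex.I * (θ:ℂ)), by fun_prop⟩
  have hs : Summable fun m => ‖b m‖ * ρ ^ m := by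
    have h1 := (hF (ρ:ℂ) (by simp [abs_of_pos hρ])).summable.norm
    refine h1.congr fun m => ?_
    rw [norm_mul, norm_pow]; simp [abs_of_pos hρ]
  have key := intervalIntegral.hasSum_intervalIntegral_of_summable_norm (a := -Real.pi) (b := Real.pi) (f := f) (by
    refine Summable.of_nonneg_of_le (fun _ => norm_nonneg _) (fun m => ?_) hs
    rw [ContinuousMap.norm_le _ (by positivity)]
    intro θ
    simp only [f, ContinuousMap.restrict_apply, ContinuousMap.coe_mk]
    rw [norm_mul, norm_mul, norm_pow]
    have : ‖Complex.exp (((((n:ℤ) - (m:ℤ) : ℤ)):ℂ) * Complex.I * ((θ:ℝ):ℂ))‖ = 1 := by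
      rw [Complex.norm_exp]; simp
    rw [this]; simp [abs_of_pos hρ])
  have e1 : ∀ θ : ℝ, ∑' m, f m θ = F ((ρ:ℂ) * Complex.exp (-((θ:ℂ) * Complex.I))) * Complex.exp (n * ((θ:ℂ) * Complex.I)) := by
    intro θ
    rw [← ((hF _ (hz θ)).mul_right _).tsum_eq]
    refine tsum_congr fun m => ?_
    simp only [f, ContinuousMap.coe_mk]
    rw [mul_pow, ← Complex.exp_nat_mul, mul_assoc (b m), mul_assoc (b m), mul_assoc ((ρ:ℂ)^m), ← Complex.exp_add]
    congr 3
    push_cast; ring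
  simp only [e1] at key
  rw [← key.tsum_eq, tsum_eq_single n]
  · simp only [f, ContinuousMap.coe_mk]
    rw [intervalIntegral.integral_const_mul, integral_exp_int, if_pos (by simp)]
    ring
  · intro m hm
    simp only [f, ContinuousMap.coe_mk]
    rw [intervalIntegral.integral_const_mul, integral_exp_int, if_neg (by omega), mul_zero]

lemma multiset_cauchy (a : ℕ → ℕ) {y δ : ℝ} (hy : 1 < y) (hδ : 0 < δ) (n M : ℕ) (hM : n ≤ M) :
    ∫ θ in (-Real.pi)..Real.pi, (∏ j ∈ Finset.range M,
      ((1 - Complex.exp (-(((δ:ℂ) + (θ:ℂ) * Complex.I) * (((j:ℝ) + 1 : ℝ) : ℂ))) / (y:ℂ) ^ (j+1)) ^ a (j + 1))⁻¹) *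
        Complex.exp (n * ((δ:ℂ) + (θ:ℂ) * Complex.I))
      = 2 * Real.pi * ((multisetCount a n : ℂ) / (y:ℂ) ^ n) := by
  have hy0 : (0:ℝ) < y := by linarith
  set ρ : ℝ := Real.exp (-δ) / y with hρd
  have hρ : 0 < ρ := by positivity
  have hρ1 : ρ < 1 := by
    rw [hρd, div_lt_one hy0]
    have : Real.exp (-δ) < 1 := by rw [Real.exp_lt_one_iff]; linarith
    linarith
  have h := cauchy_coeff _ _ hρ (fun z hz => prod_hasSum a M (z := z) (by rw [hz]; exact hρ1)) n
  rw [← multisetCount_eq_coeff a n M hM] at h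
  have e : ∀ θ : ℝ, (∏ j ∈ Finset.range M,
      ((1 - Complex.exp (-(((δ:ℂ) + (θ:ℂ) * Complex.I) * (((j:ℝ) + 1 : ℝ) : ℂ))) / (y:ℂ) ^ (j+1)) ^ a (j + 1))⁻¹) *
        Complex.exp (n * ((δ:ℂ) + (θ:ℂ) * Complex.I)) = 
      Complex.exp (n * (δ:ℂ)) * ((∏ j ∈ Finset.range M, ((1 - ((ρ:ℂ) * Complex.exp (-((θ:ℂ) * Complex.I))) ^ (j + 1)) ^ a (j + 1))⁻¹) *
        Complex.exp (n * ((θ:ℂ) * Complex.I))) := by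
    intro θ
    have e1 : ∀ j : ℕ, Complex.exp (-(((δ:ℂ) + (θ:ℂ) * Complex.I) * (((j:ℝ) + 1 : ℝ) : ℂ))) / (y:ℂ) ^ (j+1)
       = ((ρ:ℂ) * Complex.exp (-((θ:ℂ) * Complex.I))) ^ (j + 1) := by
      intro j
      rw [hρd]; push_cast
      rw [div_mul_eq_mul_div, div_pow, ← Complex.exp_add, ← Complex.exp_nat_mul]
      congr 2
      push_cast; ring
    simp only [e1]
    rw [mul_add, Complex.exp_add]; ring
  simp only [e]
  rw [intervalIntegral.integral_const_mul, h, hρd]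
  push_cast
  rw [div_pow, ← Complex.exp_nat_mul]
  have : Complex.exp (n * (δ:ℂ)) * Complex.exp (n * (-(δ:ℂ))) = 1 := by
    rw [← Complex.exp_add]; simp
  calc _ = 2 * Real.pi * ((multisetCount a n : ℂ) / (y:ℂ) ^ n) * (Complex.exp (n * (δ:ℂ)) * Complex.exp (n * (-(δ:ℂ)))) := by ring
    _ = _ := by rw [this, mul_one]

noncomputable def zt (y : ℝ) (s : ℂ) (j : ℕ) : ℂ :=
  Complex.exp (-(s * (((j:ℝ) + 1 : ℝ) : ℂ))) / (y:ℂ) ^ (j+1)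

noncomputable def gterm (a : ℕ → ℕ) (y : ℝ) (s : ℂ) (j : ℕ) : ℂ :=
  (a (j + 1) : ℂ) * Complex.log ((1 - zt y s j)⁻¹)

noncomputable def hterm (a : ℕ → ℕ) (K r y : ℝ) (j : ℕ) (s : ℂ) : ℂ :=
  gterm a y s j - (K:ℂ) * (((((j:ℝ)+1)^(r-1):ℝ):ℂ) * Complex.exp (-(s * (((j:ℝ)+1:ℝ):ℂ))))

lemma norm_exp_le_one {s : ℂ} (hs : 0 ≤ s.re) (j : ℕ) :
    ‖Complex.exp (-(s * (((j:ℝ) + 1 : ℝ) : ℂ)))‖ ≤ 1 := by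
  rw [Complex.norm_exp, Real.exp_le_one_iff, Complex.neg_re, Complex.re_mul_ofReal]
  have : 0 ≤ s.re * ((j:ℝ) + 1) := by positivity
  linarith

lemma norm_zt_le {y : ℝ} (hy : 1 < y) {s : ℂ} (hs : 0 ≤ s.re) (j : ℕ) :
    ‖zt y s j‖ ≤ (1 / y) ^ (j + 1) := by
  have hy0 : 0 < y := by linarith
  rw [zt, norm_div, norm_pow, Complex.norm_real, Real.norm_eq_abs, abs_of_pos hy0, div_pow, one_pow]
  gcongr
  exact norm_exp_le_one hs j

lemma norm_zt_le' {y : ℝ} (hy : 1 < y) {s : ℂ} (hs : 0 ≤ s.re) (j : ℕ) :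
    ‖zt y s j‖ ≤ 1 / y := by
  have hy0 : 0 < y := by linarith
  refine (norm_zt_le hy hs j).trans ?_
  have h1 : 1 / y ≤ 1 := by rw [div_le_one hy0]; linarith
  calc (1 / y) ^ (j + 1) ≤ (1 / y) ^ 1 := pow_le_pow_of_le_one (by positivity) h1 (by omega)
    _ = 1 / y := pow_one _

lemma norm_zt_lt {y : ℝ} (hy : 1 < y) {s : ℂ} (hs : 0 ≤ s.re) (j : ℕ) :
    ‖zt y s j‖ < 1 := by
  have hy0 : 0 < y := by linarith
  refine (norm_zt_le' hy hs j).trans_lt ?_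
  rw [div_lt_one hy0]; exact hy

lemma one_sub_zt_ne {y : ℝ} (hy : 1 < y) {s : ℂ} (hs : 0 ≤ s.re) (j : ℕ) :
    1 - zt y s j ≠ 0 := by
  intro h
  have h1 := norm_zt_lt hy hs j
  rw [← sub_eq_zero.1 h] at h1
  simp at h1

lemma hterm_continuousOn (a : ℕ → ℕ) (K r : ℝ) {y : ℝ} (hy : 1 < y) (j : ℕ) :
    ContinuousOn (hterm a K r y j) {s : ℂ | 0 ≤ s.re} := by
  unfold hterm gterm
  refine ContinuousOn.sub (ContinuousOn.mul continuousOn_const (ContinuousOn.clog ?_ ?_)) (by fun_prop)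
  · refine ContinuousOn.inv₀ ?_ (fun s hs => one_sub_zt_ne hy hs j)
    unfold zt
    fun_prop
  · intro s hs
    have h1 := norm_zt_lt hy hs j
    have h2 : 0 < (1 - zt y s j).re := by
      have := (Complex.re_le_norm (zt y s j))
      simp; linarith
    left
    rw [Complex.inv_re]
    have := Complex.normSq_pos.2 (one_sub_zt_ne hy hs j)
    positivity

lemma hterm_bound (a : ℕ → ℕ) (K r y ν : ℝ)
    (hK : 0 < K) (hy : 1 < y) (hν₁ : ν < 1)
    (ha : ∃ C : ℝ, 0 < C ∧ ∀ j : ℕ, 1 ≤ j →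
      |(a j : ℝ) - K * (j : ℝ) ^ (r - 1) * y ^ j| ≤ C * y ^ (ν * j)) :
    ∃ u : ℕ → ℝ, Summable u ∧ ∀ j (s : ℂ), 0 ≤ s.re → ‖hterm a K r y j s‖ ≤ u j := by
  obtain ⟨C, hC, ha⟩ := ha
  have hy0 : 0 < y := by linarith
  set q : ℝ := 1 / y with hq
  have hq0 : 0 < q := by positivity
  have hq1 : q < 1 := by rw [hq, div_lt_one hy0]; exact hy
  set p : ℝ := y ^ (ν - 1) with hp
  have hp0 : 0 < p := by positivity
  have hp1 : p < 1 := Real.rpow_lt_one_of_one_lt_of_neg hy (by linarith)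
  have hyp : ∀ j : ℕ, y ^ (ν * ((j+1 : ℕ):ℝ)) * q ^ (j + 1) = p ^ (j + 1) := by
    intro j
    rw [hp, hq, one_div, inv_pow, ← Real.rpow_natCast (y ^ (ν - 1)), ← Real.rpow_mul hy0.le,
      ← Real.rpow_natCast y, ← Real.rpow_neg hy0.le, ← Real.rpow_add hy0]
    congr 1; ring
  refine ⟨fun j => (1 - q)⁻¹ / 2 * (K * (((j:ℝ)+1)^(r-1) * q ^ (j+1)) + C * p ^ (j+1)) + C * p ^ (j+1), ?_, ?_⟩
  · have s1 := summable_rpow_geom (r - 1) hq0.le hq1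
    have s2 : Summable fun j : ℕ => p ^ (j + 1) :=
      (summable_nat_add_iff 1).2 (summable_geometric_of_lt_one hp0.le hp1)
    exact (((s1.mul_left K).add (s2.mul_left C)).mul_left _).add (s2.mul_left C)
  · intro j s hs
    have haj := ha (j + 1) (by omega)
    set A : ℝ := (a (j + 1) : ℝ) with hA
    have hA0 : 0 ≤ A := Nat.cast_nonneg _
    have ez : Complex.exp (-(s * (((j:ℝ)+1:ℝ):ℂ))) = zt y s j * (y:ℂ) ^ (j+1) := by
      rw [zt, div_mul_cancel₀]
      exact pow_ne_zero _ (by exact_mod_cast hy0.ne')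
    have dec : hterm a K r y j s = (A:ℂ) * (Complex.log ((1 - zt y s j)⁻¹) - zt y s j)
        + ((A - K * ((j:ℝ)+1)^(r-1) * y ^ (j+1) : ℝ):ℂ) * zt y s j := by
      rw [hterm, gterm, ez, hA]
      push_cast; ring
    have hz := norm_zt_le hy hs j
    have hz' := norm_zt_le' hy hs j
    have hlog := Complex.norm_log_one_sub_inv_sub_self_le (norm_zt_lt hy hs j)
    have hlog2 : ‖Complex.log ((1 - zt y s j)⁻¹) - zt y s j‖ ≤ (q ^ (j+1) * q ^ (j+1)) * ((1 - q)⁻¹ / 2) := by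
      refine hlog.trans ?_
      rw [mul_div_assoc, sq]
      have : 0 < 1 - q := by linarith
      have h3 : 0 < 1 - ‖zt y s j‖ := by linarith
      have h4 : 0 ≤ (1 - ‖zt y s j‖)⁻¹ / 2 := by positivity
      gcongr
    rw [dec]
    refine (norm_add_le _ _).trans ?_
    rw [norm_mul, norm_mul, Complex.norm_real, Complex.norm_real, Real.norm_eq_abs, Real.norm_eq_abs, abs_of_nonneg hA0]
    have hcast : (((j + 1 : ℕ)) : ℝ) = (j:ℝ) + 1 := by push_cast; ring
    have hq2 : q ^ (j+1) * y ^ (j+1) = 1 := by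
      rw [← mul_pow, hq, one_div, inv_mul_cancel₀ hy0.ne', one_pow]
    have hle : A ≤ K * ((j:ℝ)+1)^(r-1) * y ^ (j+1) + C * y ^ (ν * ((j+1:ℕ):ℝ)) := by
      have := (abs_le.1 haj).2
      rw [hcast] at this
      rw [hcast]
      linarith
    have hqq : q ^ (j+1) ≤ 1 := pow_le_one₀ hq0.le hq1.le
    have h1 : A * q ^ (j+1) * q ^ (j+1) ≤ K * (((j:ℝ)+1)^(r-1) * q ^ (j+1)) + C * p ^ (j+1) := by
      calc A * q ^ (j+1) * q ^ (j+1) ≤ (K * ((j:ℝ)+1)^(r-1) * y ^ (j+1) + C * y ^ (ν * ((j+1:ℕ):ℝ))) * q ^ (j+1) * q ^ (j+1) := by gcongr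
        _ = K * (((j:ℝ)+1)^(r-1) * q ^ (j+1)) * (q ^ (j+1) * y ^ (j+1)) + C * (y ^ (ν * ((j+1:ℕ):ℝ)) * q ^ (j+1)) * q ^ (j+1) := by ring
        _ = K * (((j:ℝ)+1)^(r-1) * q ^ (j+1)) + C * p ^ (j+1) * q ^ (j+1) := by rw [hq2, hyp, mul_one]
        _ ≤ K * (((j:ℝ)+1)^(r-1) * q ^ (j+1)) + C * p ^ (j+1) * 1 := by gcongr
        _ = _ := by ring
    have hq1' : 0 ≤ (1 - q)⁻¹ / 2 := by
      have : 0 < 1 - q := by linarith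
      positivity
    refine add_le_add ?_ ?_
    · calc A * ‖Complex.log ((1 - zt y s j)⁻¹) - zt y s j‖ ≤ A * ((q ^ (j+1) * q ^ (j+1)) * ((1 - q)⁻¹ / 2)) := by gcongr
        _ = (1 - q)⁻¹ / 2 * (A * q ^ (j+1) * q ^ (j+1)) := by ring
        _ ≤ _ := by gcongr
    · rw [hcast] at haj
      calc _ ≤ (C * y ^ (ν * ((j:ℝ)+1))) * q ^ (j+1) := by gcongr
        _ = C * (y ^ (ν * ((j+1:ℕ):ℝ)) * q ^ (j+1)) := by rw [hcast]; ring
        _ = _ := by rw [hyp]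

lemma Lser_hasSum (r : ℝ) {s : ℂ} (hs : 0 < s.re) :
    HasSum (fun j : ℕ => ((((j:ℝ)+1)^(r-1):ℝ):ℂ) * Complex.exp (-(s * (((j:ℝ)+1:ℝ):ℂ)))) (Lser r s) :=
  (summable_Lterm (r - 1) hs).hasSum

lemma count_integral (a : ℕ → ℕ) (K r : ℝ) {y δ : ℝ} (hK : 0 < K) (hy : 1 < y) (hδ : 0 < δ)
    (u : ℕ → ℝ) (hu : Summable u) (hub : ∀ j (s : ℂ), 0 ≤ s.re → ‖hterm a K r y j s‖ ≤ u j) (n : ℕ) :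
    ∫ θ in (-Real.pi)..Real.pi, Complex.exp ((K:ℂ) * Lser r ((δ:ℂ) + (θ:ℂ) * Complex.I)
      + (∑' j, hterm a K r y j ((δ:ℂ) + (θ:ℂ) * Complex.I)) + n * ((δ:ℂ) + (θ:ℂ) * Complex.I))
      = 2 * Real.pi * ((multisetCount a n : ℂ) / (y:ℂ) ^ n) := by
  have hre : ∀ θ : ℝ, ((δ:ℂ) + (θ:ℂ) * Complex.I).re = δ := by intro θ; simp
  set v : ℕ → ℝ := fun j => u j + K * (((j:ℝ)+1)^(r-1) * (Real.exp (-δ))^(j+1)) with hv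
  have hvs : Summable v := by
    refine hu.add (Summable.mul_left K (summable_rpow_geom (r-1) (Real.exp_pos _).le ?_))
    rw [Real.exp_lt_one_iff]; linarith
  have hg : ∀ θ : ℝ, ∀ j, ‖gterm a y ((δ:ℂ) + (θ:ℂ) * Complex.I) j‖ ≤ v j := by
    intro θ j
    have e : gterm a y ((δ:ℂ) + (θ:ℂ) * Complex.I) j = hterm a K r y j ((δ:ℂ) + (θ:ℂ) * Complex.I) +
       (K:ℂ) * (((((j:ℝ)+1)^(r-1):ℝ):ℂ) * Complex.exp (-(((δ:ℂ) + (θ:ℂ) * Complex.I) * (((j:ℝ)+1:ℝ):ℂ)))) := by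
      rw [hterm]; ring
    rw [e]
    refine (norm_add_le _ _).trans (add_le_add (hub j _ (by rw [hre]; exact hδ.le)) ?_)
    rw [norm_mul, norm_Lterm, hre, Complex.norm_real, Real.norm_eq_abs, abs_of_pos hK]
  have hv0 : ∀ j, 0 ≤ v j := fun j => (norm_nonneg _).trans (hg 0 j)
  have hprod : ∀ θ : ℝ, ∀ M : ℕ, (∏ j ∈ Finset.range M,
      ((1 - Complex.exp (-(((δ:ℂ) + (θ:ℂ) * Complex.I) * (((j:ℝ) + 1 : ℝ) : ℂ))) / (y:ℂ) ^ (j+1)) ^ a (j + 1))⁻¹)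
      = Complex.exp (∑ j ∈ Finset.range M, gterm a y ((δ:ℂ) + (θ:ℂ) * Complex.I) j) := by
    intro θ M
    rw [Complex.exp_sum]
    refine Finset.prod_congr rfl fun j _ => ?_
    rw [gterm, Complex.exp_nat_mul, Complex.exp_log, inv_pow]
    · rfl
    · exact inv_ne_zero (one_sub_zt_ne hy (by rw [hre]; exact hδ.le) j)
  have hsum : ∀ θ : ℝ, HasSum (gterm a y ((δ:ℂ) + (θ:ℂ) * Complex.I)) ((K:ℂ) * Lser r ((δ:ℂ) + (θ:ℂ) * Complex.I)
      + (∑' j, hterm a K r y j ((δ:ℂ) + (θ:ℂ) * Complex.I))) := by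
    intro θ
    have h1 := (Lser_hasSum r (s := (δ:ℂ) + (θ:ℂ) * Complex.I) (by rw [hre]; exact hδ)).mul_left (K:ℂ)
    have h2 : HasSum (fun j => hterm a K r y j ((δ:ℂ) + (θ:ℂ) * Complex.I)) _ :=
      (Summable.of_norm_bounded hu (fun j => hub j _ (by rw [hre]; exact hδ.le))).hasSum
    refine (h1.add h2).congr_fun ?_
    intro j
    rw [hterm]; ring
  have hlim : Tendsto (fun M : ℕ => ∫ θ in (-Real.pi)..Real.pi, (∏ j ∈ Finset.range M,
      ((1 - Complex.exp (-(((δ:ℂ) + (θ:ℂ) * Complex.I) * (((j:ℝ) + 1 : ℝ) : ℂ))) / (y:ℂ) ^ (j+1)) ^ a (j + 1))⁻¹) *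
        Complex.exp (n * ((δ:ℂ) + (θ:ℂ) * Complex.I))) atTop (nhds (∫ θ in (-Real.pi)..Real.pi, Complex.exp ((K:ℂ) * Lser r ((δ:ℂ) + (θ:ℂ) * Complex.I)
      + (∑' j, hterm a K r y j ((δ:ℂ) + (θ:ℂ) * Complex.I)) + n * ((δ:ℂ) + (θ:ℂ) * Complex.I)))) := by
    refine intervalIntegral.tendsto_integral_filter_of_dominated_convergence
      (fun _ => Real.exp (∑' j, v j) * Real.exp (n * δ)) ?_ ?_ (by simp) ?_
    · refine Eventually.of_forall fun M => Measurable.aestronglyMeasurable ?_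
      fun_prop
    · refine Eventually.of_forall fun M => Eventually.of_forall fun θ _ => ?_
      rw [hprod, norm_mul, Complex.norm_exp, Complex.norm_exp]
      refine mul_le_mul ?_ ?_ (Real.exp_pos _).le (Real.exp_pos _).le
      · rw [Real.exp_le_exp]
        refine (Complex.re_le_norm _).trans ((norm_sum_le _ _).trans ?_)
        exact (Finset.sum_le_sum fun j _ => hg θ j).trans (hvs.sum_le_tsum _ fun j _ => hv0 j)
      · apply le_of_eq; congr 1; simp
    · refine Eventually.of_forall fun θ _ => ?_
      simp only [hprod]
      rw [Complex.exp_add]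
      exact ((Complex.continuous_exp.tendsto _).comp (hsum θ).tendsto_sum_nat).mul_const _
  refine tendsto_nhds_unique hlim (tendsto_const_nhds.congr' ?_)
  filter_upwards [eventually_ge_atTop n] with M hM
  exact (multiset_cauchy a hy hδ n M hM).symm

lemma exp_rpow' (x p : ℝ) : Real.exp x ^ p = Real.exp (x * p) := (Real.exp_mul x p).symm

lemma final_algebra {G r : ℝ} (hG : 0 < G) (hr : 0 < r) {n : ℝ} (hn : 0 < n) :
    G * ((G / n) ^ (1 / (r + 1))) ^ (-r - 1) = n ∧
    G * ((G / n) ^ (1 / (r + 1))) ^ (-r) * (1 + 1 / r) =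
      ((r + 1) / r * G ^ (1 / (r + 1))) * n ^ (r / (r + 1)) ∧
    Real.sqrt (G * ((G / n) ^ (1 / (r + 1))) ^ (-r)) / ((G / n) ^ (1 / (r + 1))) *
      (G ^ (1 / (2 * (r + 1))) * n ^ (-(r + 2) / (2 * (r + 1)))) = 1 := by
  obtain ⟨g, rfl⟩ : ∃ g, G = Real.exp g := ⟨Real.log G, (Real.exp_log hG).symm⟩
  obtain ⟨m, rfl⟩ : ∃ m, n = Real.exp m := ⟨Real.log n, (Real.exp_log hn).symm⟩
  have h1 : r + 1 ≠ 0 := by positivity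
  have hr0 : r ≠ 0 := hr.ne'
  simp only [← Real.exp_sub, exp_rpow', ← Real.exp_add]
  refine ⟨?_, ?_, ?_⟩
  · congr 1; field_simp; ring
  · rw [mul_assoc ((r+1)/r), ← Real.exp_add, mul_comm]
    congr 1
    · field_simp
    · congr 1; field_simp; ring
  · rw [← Real.exp_half, ← Real.exp_sub, ← Real.exp_add, Real.exp_eq_one_iff]
    field_simp; ring

/-- if `a_j = K j^{r-1} y^j + O(y^{νj})` with `K > 0`, `r > 0`, `y > 1`,
`ν ∈ (0,1)`, then there is `κ₁ > 0` such that
`c_n ∼ κ₁ y^n n^{-(r+2)/(2(r+1))} exp(κ₂ n^{r/(r+1)})`, where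
`κ₂ = ((r+1)/r)(K Γ(r+1))^{1/(r+1)}`. -/
theorem multiset_explicit_asymptotics (a : ℕ → ℕ) (K r y ν : ℝ)
    (hK : 0 < K) (hr : 0 < r) (hy : 1 < y) (hν₀ : 0 < ν) (hν₁ : ν < 1)
    (ha : ∃ C : ℝ, 0 < C ∧ ∀ j : ℕ, 1 ≤ j →
      |(a j : ℝ) - K * (j : ℝ) ^ (r - 1) * y ^ j| ≤ C * y ^ (ν * j)) :
    ∃ κ₁ : ℝ, 0 < κ₁ ∧
      Tendsto (fun n : ℕ =>
        (multisetCount a n : ℝ) /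
          (κ₁ * y ^ n * (n : ℝ) ^ (-(r + 2) / (2 * (r + 1))) *
            Real.exp (((r + 1) / r * (K * Real.Gamma (r + 1)) ^ (1 / (r + 1))) *
              (n : ℝ) ^ (r / (r + 1)))))
        atTop (nhds 1) := by
  obtain ⟨u, hu, hub⟩ := hterm_bound a K r y ν hK hy hν₁ ha
  obtain ⟨D0, M, hD⟩ := Dser_lim hr
  have hy0 : 0 < y := by linarith
  set h : ℂ → ℂ := fun s => ∑' j, hterm a K r y j s with hh
  have hcont : ContinuousOn h {s : ℂ | 0 ≤ s.re} :=
    continuousOn_tsum (fun j => hterm_continuousOn a K r hy j) hu (fun j s hs => hub j s hs)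
  have hhb : ∀ s : ℂ, 0 ≤ s.re → ‖h s‖ ≤ ∑' j, u j := fun s hs =>
    tsum_of_norm_bounded hu.hasSum (fun j => hub j s hs)
  set A : ℝ := K * Real.Gamma r with hA
  have hΓ := Real.Gamma_pos_of_pos hr
  have hA0 : 0 < A := by positivity
  set G : ℝ := K * Real.Gamma (r + 1) with hG
  have hGA : G = r * A := by rw [hG, hA, Real.Gamma_add_one hr.ne']; ring
  have hG0 : 0 < G := by rw [hGA]; positivity
  have hS := saddle hA0 hr (fun s => (K:ℂ) * Dser r s + h s) ((K:ℂ) * D0 + h 0)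
    (K * (‖D0‖ + |M| * (1 + Real.pi)) + ∑' j, u j)
    (by
      refine ContinuousOn.add (ContinuousOn.mul continuousOn_const ?_) (hcont.mono fun s (hs : 0 < s.re) => show 0 ≤ s.re from hs.le)
      intro s hs
      exact (Dser_deriv hr hs).continuousAt.continuousWithinAt)
    (by
      intro s hs hs1 him
      refine (norm_add_le _ _).trans (add_le_add ?_ (hhb s hs.le))
      rw [norm_mul, Complex.norm_real, Real.norm_eq_abs, abs_of_pos hK]
      refine mul_le_mul_of_nonneg_left ?_ hK.le
      have e : Dser r s = D0 + (Dser r s - D0) := by ring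
      rw [e]
      refine (norm_add_le _ _).trans (add_le_add le_rfl ((hD s hs him).trans ?_))
      have h1 : ‖s‖ ≤ 1 + Real.pi := by
        refine (Complex.norm_le_abs_re_add_abs_im s).trans (add_le_add ?_ him)
        rw [abs_of_pos hs]; exact hs1
      calc M * ‖s‖ ≤ |M| * ‖s‖ := by gcongr; exact le_abs_self M
        _ ≤ _ := by gcongr)
    (by
      refine Tendsto.add (Tendsto.const_mul _ ?_) ?_
      · rw [tendsto_iff_norm_sub_tendsto_zero]
        have h0 : Tendsto (fun s : ℂ => M * ‖s‖) (nhdsWithin 0 {s:ℂ | 0<s.re ∧ |s.im|≤Real.pi}) (nhds 0) := by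
          have : Tendsto (fun s : ℂ => M * ‖s‖) (nhds 0) (nhds (M * ‖(0:ℂ)‖)) :=
            (continuous_const.mul continuous_norm).tendsto 0
          rw [norm_zero, mul_zero] at this
          exact this.mono_left nhdsWithin_le_nhds
        refine squeeze_zero' (Eventually.of_forall fun _ => norm_nonneg _) ?_ h0
        filter_upwards [self_mem_nhdsWithin] with s hs using hD s hs.1 hs.2
      · have : ContinuousWithinAt h {s : ℂ | 0 ≤ s.re} 0 := hcont 0 (by simp)
        exact Tendsto.mono_left this (nhdsWithin_mono _ fun s hs => show 0 ≤ s.re from le_of_lt hs.1))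
  set δ : ℕ → ℝ := fun n => (G / n) ^ (1 / (r + 1)) with hδ
  have hδt : Tendsto δ atTop (nhdsWithin 0 (Set.Ioi 0)) := by
    rw [tendsto_nhdsWithin_iff]
    constructor
    · have h1 : Tendsto (fun n : ℕ => G / (n:ℝ)) atTop (nhds 0) := tendsto_const_div_atTop_nhds_zero_nat G
      have h2 := h1.rpow_const (p := 1 / (r + 1)) (Or.inr (by positivity))
      rwa [Real.zero_rpow (by positivity)] at h2
    · filter_upwards [eventually_gt_atTop 0] with n hn
      have : (0:ℝ) < n := by exact_mod_cast hn
      show 0 < (G / n) ^ (1 / (r + 1))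
      positivity
  have hN := (hS.comp hδt).norm
  set ℓ : ℝ := ‖Complex.exp ((K:ℂ) * D0 + h 0) * (Real.sqrt (Real.pi/((r+1)/2)) : ℂ)‖ with hℓ
  have hℓ0 : 0 < ℓ := by
    rw [hℓ, norm_mul, Complex.norm_real, Real.norm_eq_abs]
    have : 0 < Real.sqrt (Real.pi/((r+1)/2)) := Real.sqrt_pos.2 (by positivity)
    have h2 := norm_pos_iff.2 (Complex.exp_ne_zero ((K:ℂ) * D0 + h 0))
    positivity
  refine ⟨ℓ * G ^ (1 / (2 * (r + 1))) / (2 * Real.pi), by positivity, ?_⟩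
  have hN2 := hN.div_const ℓ
  rw [div_self hℓ0.ne'] at hN2
  refine hN2.congr' ?_
  filter_upwards [eventually_gt_atTop 0] with n hn
  have hn0 : (0:ℝ) < n := by exact_mod_cast hn
  have hδ0 : 0 < δ n := by simp only [hδ]; positivity
  obtain ⟨e1, e2, e3⟩ := final_algebra hG0 hr hn0
  change G * δ n ^ (-r - 1) = n at e1
  change G * δ n ^ (-r) * (1 + 1 / r) = _ at e2
  change Real.sqrt (G * δ n ^ (-r)) / δ n * _ = 1 at e3
  have hI := count_integral a K r hK hy hδ0 u hu hub n
  have hI2 : ∫ θ in (-Real.pi)..Real.pi, Complex.exp ((A:ℂ)*(((δ n : ℝ):ℂ)+(θ:ℂ)*Complex.I)^(-(r:ℂ))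
      + ((r*A*(δ n)^(-r-1):ℝ):ℂ)*(((δ n:ℝ):ℂ)+(θ:ℂ)*Complex.I)
      + ((K:ℂ) * Dser r (((δ n:ℝ):ℂ)+(θ:ℂ)*Complex.I) + h (((δ n:ℝ):ℂ)+(θ:ℂ)*Complex.I)))
      = 2 * Real.pi * ((multisetCount a n : ℂ) / (y:ℂ) ^ n) := by
    rw [← hI]
    refine intervalIntegral.integral_congr fun θ _ => ?_
    show Complex.exp _ = Complex.exp _
    rw [← hGA, e1]
    congr 1
    rw [Dser, hA, hh]
    push_cast
    ring
  simp only [Function.comp]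
  rw [hI2, ← hGA, e2, norm_mul, norm_mul, norm_mul, norm_div, norm_pow]
  simp only [Complex.norm_real, Complex.norm_natCast, Complex.norm_ofNat, Real.norm_eq_abs,
    abs_of_pos hy0, abs_of_pos Real.pi_pos]
  set S : ℝ := Real.sqrt (G * δ n ^ (-r)) / δ n with hSd
  have hS0 : 0 < S := div_pos (Real.sqrt_pos.2 (by positivity)) hδ0
  set E : ℝ := ((r + 1) / r * G ^ (1 / (r + 1))) * (n:ℝ) ^ (r / (r + 1)) with hE
  rw [abs_of_pos (mul_pos hS0 (Real.exp_pos _)), Real.exp_neg]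
  set P : ℝ := G ^ (1 / (2 * (r + 1))) with hP
  set Q : ℝ := (n:ℝ) ^ (-(r + 2) / (2 * (r + 1))) with hQ
  have hP0 : 0 < P := by positivity
  have hQ0 : 0 < Q := by positivity
  have hSe : S = (P * Q)⁻¹ := eq_inv_of_mul_eq_one_left e3
  rw [hSe]
  have hE0 := Real.exp_pos E
  field_simp
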